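/- Suppose α, β > 0, α(‖P‖ + β‖H‖²) < 1, and ρ ∈ (0, 2), and let (z^j, w^j, ξ^j, η^j) be the xPIPG iterates from arbitrary initial points ξ¹ ∈ ℝ^n, η¹ ∈ ℝ^m, with limits z̄ := lim_{j→∞} (z^{j+1} − z^j) and w̄ := lim_{j→∞} (w^{j+1} − w^j) (which exist). Then σ_D(−Hᵀw̄) + ⟨q, z̄⟩ + ⟨g, w̄⟩ + (1/(ρα))‖z̄‖² + (1/(ρβ))‖w̄‖² ≥ 0. -/

import Mathlib

open scoped RealInnerProductSpace
open Filter Topology Matrix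

/-- Spectral norm (largest singular value) of a real matrix. -/
noncomputable def specNorm {ι κ : Type*} [Fintype ι] [Fintype κ] [DecidableEq κ]
    (A : Matrix ι κ ℝ) : ℝ :=
  ‖LinearMap.toContinuousLinearMap (Matrix.toEuclideanLin A)‖

/-- The linear map on Euclidean space induced by a matrix (matrix-vector product). -/
noncomputable def mvec {ι κ : Type*} [Fintype ι] [Fintype κ] [DecidableEq κ]
    (A : Matrix ι κ ℝ) (x : EuclideanSpace ℝ κ) : EuclideanSpace ℝ ι :=
  Matrix.toEuclideanLin A x

open Classical in
/-- Projection onto a (nonempty closed convex) set: the minimizer of the distance to `x`. -/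
noncomputable def proj {ι : Type*} [Fintype ι] (C : Set (EuclideanSpace ℝ ι))
    (x : EuclideanSpace ℝ ι) : EuclideanSpace ℝ ι :=
  if h : ∃ y ∈ C, ∀ c ∈ C, ‖x - y‖ ≤ ‖x - c‖ then h.choose else x

/-- Polar cone `K° = {w | ⟨w, y⟩ ≤ 0 for all y ∈ K}`. -/
def polarCone {ι : Type*} [Fintype ι] (K : Set (EuclideanSpace ℝ ι)) :
    Set (EuclideanSpace ℝ ι) := {w | ∀ y ∈ K, ⟪w, y⟫ ≤ 0}

/-- Recession cone `rec D = {y | y + z ∈ D for all z ∈ D}`. -/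
def recCone {ι : Type*} [Fintype ι] (D : Set (EuclideanSpace ℝ ι)) :
    Set (EuclideanSpace ℝ ι) := {y | ∀ z ∈ D, y + z ∈ D}

/-- Normal cone of `C` at `x`: `N_C(x) = {y | ⟨y, x' − x⟩ ≤ 0 for all x' ∈ C}`. -/
def normalCone {ι : Type*} [Fintype ι] (C : Set (EuclideanSpace ℝ ι))
    (x : EuclideanSpace ℝ ι) : Set (EuclideanSpace ℝ ι) :=
  {y | ∀ x' ∈ C, ⟪y, x' - x⟫ ≤ 0}

/-- A closed convex cone. -/
def IsClosedConvexCone {ι : Type*} [Fintype ι] (K : Set (EuclideanSpace ℝ ι)) : Prop :=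
  IsClosed K ∧ Convex ℝ K ∧ ∀ w ∈ K, ∀ c : ℝ, 0 ≤ c → c • w ∈ K

/-- Support function of `D`, valued in `EReal`: `σ_D(x) = sup_{y ∈ D} ⟨y, x⟩`. -/
noncomputable def supportF {ι : Type*} [Fintype ι] (D : Set (EuclideanSpace ℝ ι))
    (x : EuclideanSpace ℝ ι) : EReal :=
  ⨆ y : D, ((⟪(y : EuclideanSpace ℝ ι), x⟫ : ℝ) : EReal)


theorem tendsto_of_affine_recurrence {E : Type*} [NormedAddCommGroup E] [NormedSpace ℝ E]
    {r : ℝ} (hr : |r| < 1) {s e : ℕ → E} {a : E} (hs : ∀ j, s (j + 1) = e j + r • s j)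
    (he : Tendsto e atTop (𝓝 a)) : Tendsto s atTop (𝓝 ((1 - r)⁻¹ • a)) := by
  have h1r : (1 - r) ≠ 0 := by
    have := (abs_lt.1 hr).2
    linarith
  set L := (1 - r)⁻¹ • a with hL
  have haL : a = L - r • L := by
    rw [hL, ← one_smul ℝ ((1 - r)⁻¹ • a), smul_smul r, ← sub_smul, smul_smul]
    simp [h1r]
  have hrec : ∀ j, s (j + 1) - L = (e j - a) + r • (s j - L) := by
    intro j
    rw [hs, haL, smul_sub]
    abel
  rw [Metric.tendsto_atTop]
  intro ε hε
  have hδ : 0 < (1 - |r|) * (ε / 2) := mul_pos (by linarith) (by linarith)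
  obtain ⟨N, hN⟩ := Metric.tendsto_atTop.1 he _ hδ
  have hbound : ∀ k, ‖s (N + k) - L‖ ≤ |r| ^ k * ‖s N - L‖ + ε / 2 := by
    intro k
    induction k with
    | zero => simp; linarith
    | succ k ih =>
      rw [← add_assoc, hrec]
      have h1 := hN (N + k) (by omega)
      rw [dist_eq_norm] at h1
      have h2 := norm_add_le (e (N + k) - a) (r • (s (N + k) - L))
      rw [norm_smul, Real.norm_eq_abs] at h2
      have h3 := mul_le_mul_of_nonneg_left ih (abs_nonneg r)
      rw [pow_succ]
      nlinarith
  have hpow : Tendsto (fun k : ℕ => |r| ^ k * ‖s N - L‖) atTop (𝓝 0) := by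
    simpa using (tendsto_pow_atTop_nhds_zero_of_lt_one (abs_nonneg r) hr).mul_const ‖s N - L‖
  obtain ⟨M, hM⟩ := eventually_atTop.1 (hpow.eventually_lt_const (half_pos hε))
  refine ⟨N + M, fun j hj => ?_⟩
  obtain ⟨k, rfl⟩ := Nat.exists_eq_add_of_le (le_trans (Nat.le_add_right N M) hj)
  have h1 := hM k (by omega)
  have h2 := hbound k
  rw [dist_eq_norm]
  linarith

theorem tendsto_inv_smul_of_tendsto_sub {E : Type*} [NormedAddCommGroup E] [NormedSpace ℝ E]
    {u : ℕ → E} {a : E} (hu : Tendsto (fun j => u (j + 1) - u j) atTop (𝓝 a)) :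
    Tendsto (fun j : ℕ => (j : ℝ)⁻¹ • u j) atTop (𝓝 a) := by
  have h := hu.cesaro_smul
  simp only [Finset.sum_range_sub] at h
  have h0 : Tendsto (fun j : ℕ => (j : ℝ)⁻¹ • u 0) atTop (𝓝 0) := by
    simpa using (tendsto_inv_atTop_nhds_zero_nat (𝕜 := ℝ)).smul_const (u 0)
  simpa [smul_sub] using h.add h0

theorem add_mem_of_tendsto_inv_smul {E : Type*} [NormedAddCommGroup E] [NormedSpace ℝ E]
    {D : Set E} (hcl : IsClosed D) (hcv : Convex ℝ D) {u : ℕ → E} (hu : ∀ j, u j ∈ D) {a x : E}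
    (hlim : Tendsto (fun j : ℕ => (j : ℝ)⁻¹ • u j) atTop (𝓝 a)) (hx : x ∈ D) : x + a ∈ D := by
  have h1 : Tendsto (fun j : ℕ => (1 - (j : ℝ)⁻¹) • x + (j : ℝ)⁻¹ • u j) atTop (𝓝 (x + a)) := by
    simpa using
      (((tendsto_const_nhds (x := (1 : ℝ))).sub (tendsto_inv_atTop_nhds_zero_nat (𝕜 := ℝ))).smul_const x).add hlim
  refine hcl.mem_of_tendsto h1 (eventually_atTop.2 ⟨1, fun j hj => ?_⟩)
  have hj' : (1 : ℝ) ≤ j := by exact_mod_cast hj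
  exact hcv hx (hu j) (sub_nonneg.2 (inv_le_one_of_one_le₀ hj')) (by positivity) (by ring)

theorem proj_spec {ι : Type*} [Fintype ι] {C : Set (EuclideanSpace ℝ ι)} (hne : C.Nonempty)
    (hcl : IsClosed C) (hcv : Convex ℝ C) (x : EuclideanSpace ℝ ι) :
    proj C x ∈ C ∧ ∀ c ∈ C, ⟪x - proj C x, c - proj C x⟫ ≤ 0 := by
  have : Nonempty C := hne.to_subtype
  have hbdd : BddBelow (Set.range fun c : C => ‖x - c‖) :=
    ⟨0, by rintro _ ⟨c, rfl⟩; exact norm_nonneg _⟩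
  have h : ∃ y ∈ C, ∀ c ∈ C, ‖x - y‖ ≤ ‖x - c‖ := by
    obtain ⟨y, hy, hxy⟩ := exists_norm_eq_iInf_of_complete_convex hne hcl.isComplete hcv x
    exact ⟨y, hy, fun c hc => hxy ▸ ciInf_le hbdd ⟨c, hc⟩⟩
  have hp : proj C x = h.choose := by
    unfold proj
    exact dif_pos h
  rw [hp]
  obtain ⟨hmem, hmin⟩ := h.choose_spec
  refine ⟨hmem, (norm_eq_iInf_iff_real_inner_le_zero hcv hmem).1 (le_antisymm ?_ ?_)⟩
  · exact le_ciInf fun c => hmin c c.2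
  · exact ciInf_le hbdd ⟨_, hmem⟩

/-- Asymptotic consequences of the primal-dual variational inequalities along a sequence growing
linearly in the direction `(a, b)`. -/
theorem asymptotic_primal_dual {E F : Type*} [NormedAddCommGroup E] [InnerProductSpace ℝ E]
    [NormedAddCommGroup F] [InnerProductSpace ℝ F] {P : E →L[ℝ] E} {H : E →L[ℝ] F}
    {Ht : F →L[ℝ] E} (hadj : ∀ x y, ⟪Ht y, x⟫ = ⟪y, H x⟫)
    (hP : ∀ x, ⟪P x, x⟫ ≤ 0 → ∀ y, ⟪P y, x⟫ = 0) {D : Set E} {C : Set F}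
    (hDcl : IsClosed D) (hDcv : Convex ℝ D) (hCcl : IsClosed C)
    (hC0 : 0 ∈ C) (hCadd : ∀ u ∈ C, ∀ v ∈ C, u + v ∈ C)
    (hCsmul : ∀ u ∈ C, ∀ c : ℝ, 0 ≤ c → c • u ∈ C)
    {α β ρ : ℝ} (hα : 0 < α) (hβ : 0 < β) {q : E} {g : F} {x z : ℕ → E} {y w : ℕ → F}
    (hz : ∀ j, z j ∈ D) (hw : ∀ j, w j ∈ C)
    (hz' : ∀ j, ∀ v ∈ D, ⟪x j - α • (P (x j) + q + Ht (y j)) - z j, v - z j⟫ ≤ 0)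
    (hw' : ∀ j, ∀ v ∈ C, ⟪y j + β • (H ((2 : ℝ) • z j - x j) - g) - w j, v - w j⟫ ≤ 0)
    {a : E} {b : F}
    (hzx : Tendsto (fun j => z j - x j) atTop (𝓝 (ρ⁻¹ • a)))
    (hwy : Tendsto (fun j => w j - y j) atTop (𝓝 (ρ⁻¹ • b)))
    (hza : Tendsto (fun j : ℕ => (j : ℝ)⁻¹ • z j) atTop (𝓝 a))
    (hwb : Tendsto (fun j : ℕ => (j : ℝ)⁻¹ • w j) atTop (𝓝 b)) :
    0 ≤ ⟪q, a⟫ + 1 / (ρ * α) * ‖a‖ ^ 2 ∧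
      ∃ r : ℕ → ℝ, Tendsto r atTop (𝓝 (-(⟪g, b⟫ + 1 / (ρ * β) * ‖b‖ ^ 2))) ∧
        ∀ j, r j ≤ ⟪z j, -(Ht b)⟫ := by
  have hc0 := tendsto_inv_atTop_nhds_zero_nat (𝕜 := ℝ)
  have hc (j : ℕ) : 0 ≤ (j : ℝ)⁻¹ := by positivity
  have hbC : b ∈ C := hCcl.mem_of_tendsto hwb (.of_forall fun j => hCsmul _ (hw j) _ (hc j))
  let p : ℕ → E := fun j => -(z j - x j) - α • (P (x j) + q + Ht (y j))
  let d : ℕ → F := fun j => -(w j - y j) + β • (H (z j) + H (z j - x j) - g)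
  have hp : ∀ j, ∀ v ∈ D, ⟪p j, v - z j⟫ ≤ 0 := by
    intro j v hv
    convert hz' j v hv using 2
    simp only [p]
    abel
  have hd : ∀ j, ∀ v ∈ C, ⟪d j, v - w j⟫ ≤ 0 := by
    intro j v hv
    convert hw' j v hv using 2
    simp only [d, two_smul, map_sub, map_add]
    rw [show H (z j) + (H (z j) - H (x j)) - g = H (z j) + H (z j) - H (x j) - g by abel]
    abel
  have hdpolar : ∀ j, ∀ v ∈ C, ⟪d j, v⟫ ≤ 0 := by
    intro j v hv
    simpa using hd j (v + w j) (hCadd _ hv _ (hw j))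
  have hdw : ∀ j, ⟪d j, w j⟫ = 0 := by
    intro j
    have h1 := hd j 0 hC0
    have h2 := hdpolar j _ (hw j)
    simp only [zero_sub, inner_neg_right] at h1
    linarith
  have hxa : Tendsto (fun j : ℕ => (j : ℝ)⁻¹ • x j) atTop (𝓝 a) := by
    simpa [smul_sub] using hza.sub (hc0.smul hzx)
  have hyb : Tendsto (fun j : ℕ => (j : ℝ)⁻¹ • y j) atTop (𝓝 b) := by
    simpa [smul_sub] using hwb.sub (hc0.smul hwy)
  have hplim : Tendsto (fun j : ℕ => (j : ℝ)⁻¹ • p j) atTop (𝓝 (-(α • (P a + Ht b)))) := by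
    have h := (hc0.smul hzx).neg.sub
      (((((P.continuous.tendsto a).comp hxa).add (hc0.smul_const q)).add
        ((Ht.continuous.tendsto b).comp hyb)).const_smul α)
    refine (h.congr fun j => ?_).trans (by simp)
    simp only [p, Function.comp, map_smul]
    module
  have hdlim : Tendsto (fun j : ℕ => (j : ℝ)⁻¹ • d j) atTop (𝓝 (β • H a)) := by
    have h := (hc0.smul hwy).neg.add
      (((((H.continuous.tendsto a).comp hza).add
        (hc0.smul ((H.continuous.tendsto _).comp hzx))).sub (hc0.smul_const g)).const_smul β)
    refine (h.congr fun j => ?_).trans (by simp)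
    simp only [d, Function.comp, map_smul]
    module
  have hHpolar : ∀ v ∈ C, ⟪H a, v⟫ ≤ 0 := by
    intro v hv
    have h : ⟪β • H a, v⟫ ≤ 0 := by
      refine le_of_tendsto (hdlim.inner tendsto_const_nhds) (.of_forall fun j => ?_)
      rw [real_inner_smul_left]
      exact mul_nonpos_of_nonneg_of_nonpos (hc j) (hdpolar j v hv)
    rw [real_inner_smul_left] at h
    exact nonpos_of_mul_nonpos_right h hβ
  have hHab : ⟪H a, b⟫ = 0 := by
    have h : ⟪β • H a, b⟫ = 0 := by
      refine tendsto_nhds_unique (hdlim.inner hwb) (tendsto_const_nhds.congr fun j => ?_)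
      rw [real_inner_smul_left, real_inner_smul_right, hdw]
      simp
    rw [real_inner_smul_left] at h
    exact (mul_eq_zero.1 h).resolve_left hβ.ne'
  have hPa : ∀ v, ⟪P v, a⟫ = 0 := by
    refine hP a ?_
    have h : ⟪-(α • (P a + Ht b)), 0 - a⟫ ≤ 0 := by
      have h0 : Tendsto (fun j : ℕ => (j : ℝ)⁻¹ • z 0) atTop (𝓝 0) := by
        simpa using hc0.smul_const (z 0)
      refine le_of_tendsto (hplim.inner (h0.sub hza)) (.of_forall fun j => ?_)
      rw [← smul_sub, real_inner_smul_left, real_inner_smul_right]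
      exact mul_nonpos_of_nonneg_of_nonpos (hc j)
        (mul_nonpos_of_nonneg_of_nonpos (hc j) (hp j _ (hz 0)))
    simp only [zero_sub, inner_neg_left, inner_neg_right, neg_neg, real_inner_smul_left,
      inner_add_left, hadj, real_inner_comm (H a) b, hHab, add_zero] at h
    exact nonpos_of_mul_nonpos_right h hα
  constructor
  · have hlim : Tendsto (fun j => ⟪-(z j - x j), a⟫ - α * (⟪q, a⟫ - ⟪w j - y j, H a⟫)) atTop
        (𝓝 (⟪-(ρ⁻¹ • a), a⟫ - α * (⟪q, a⟫ - ⟪ρ⁻¹ • b, H a⟫))) :=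
      (hzx.neg.inner tendsto_const_nhds).sub
        ((tendsto_const_nhds.sub (hwy.inner tendsto_const_nhds)).const_mul α)
    have h := le_of_tendsto hlim (b := 0) (.of_forall fun j => ?_)
    · rw [real_inner_smul_left, real_inner_comm (H a) b, hHab, inner_neg_left,
        real_inner_smul_left, real_inner_self_eq_norm_sq] at h
      have h' : 0 ≤ α * (⟪q, a⟫ + 1 / (ρ * α) * ‖a‖ ^ 2) := by
        have e : α * (1 / (ρ * α) * ‖a‖ ^ 2) = ρ⁻¹ * ‖a‖ ^ 2 := by
          rw [one_div, mul_inv]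
          field_simp
        rw [mul_add, e]
        linarith
      exact nonneg_of_mul_nonneg_right h' hα
    · have h1 := hp j (z j + a) (add_mem_of_tendsto_inv_smul hDcl hDcv hz hza (hz j))
      have h2 := hHpolar _ (hw j)
      simp only [p, add_sub_cancel_left, inner_sub_left (𝕜 := ℝ) (-(z j - x j)),
        real_inner_smul_left, inner_add_left, hPa, hadj] at h1
      rw [inner_sub_left (w j), real_inner_comm (H a) (w j)]
      have h3 := mul_nonpos_of_nonneg_of_nonpos hα.le h2
      linarith
  · refine ⟨fun j => β⁻¹ * ⟪-(w j - y j), b⟫ + ⟪H (z j - x j) - g, b⟫, ?_, fun j => ?_⟩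
    · have h := ((hwy.neg.inner (tendsto_const_nhds (x := b))).const_mul β⁻¹).add
        ((((H.continuous.tendsto _).comp hzx).sub_const g).inner (tendsto_const_nhds (x := b)))
      refine h.trans (le_of_eq ?_)
      congr 1
      rw [map_smul, inner_sub_left, real_inner_smul_left, hHab, inner_neg_left,
        real_inner_smul_left, real_inner_self_eq_norm_sq, one_div, mul_inv]
      ring
    · have h := hdpolar j b hbC
      simp only [d] at h
      rw [inner_add_left, real_inner_smul_left, add_sub_assoc, inner_add_left] at h
      rw [inner_neg_right, real_inner_comm, hadj, real_inner_comm]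
      have h' : β * (β⁻¹ * ⟪-(w j - y j), b⟫ + ⟪H (z j - x j) - g, b⟫ + ⟪H (z j), b⟫) ≤ 0 := by
        rw [mul_add, mul_add, ← mul_assoc, mul_inv_cancel₀ hβ.ne']
        linarith
      have := nonpos_of_mul_nonpos_right h' hβ
      linarith

/-- the inequality
`σ_D(−Hᵀw̄) + ⟨q, z̄⟩ + ⟨g, w̄⟩ + (1/(ρα))‖z̄‖² + (1/(ρβ))‖w̄‖² ≥ 0` for the xPIPG limits. -/
theorem stmt14 {n m : ℕ} (P : Matrix (Fin n) (Fin n) ℝ) (q : EuclideanSpace ℝ (Fin n))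
    (H : Matrix (Fin m) (Fin n) ℝ) (g : EuclideanSpace ℝ (Fin m))
    (D : Set (EuclideanSpace ℝ (Fin n))) (K : Set (EuclideanSpace ℝ (Fin m)))
    (hP : P.PosSemidef)
    (hDne : D.Nonempty) (hDcl : IsClosed D) (hDcv : Convex ℝ D)
    (hKne : K.Nonempty) (hK : IsClosedConvexCone K)
    (α β ρ : ℝ) (hα : 0 < α) (hβ : 0 < β)
    (hstep : α * (specNorm P + β * specNorm H ^ 2) < 1)
    (hρ : ρ ∈ Set.Ioo (0 : ℝ) 2)
    (z ξ : ℕ → EuclideanSpace ℝ (Fin n)) (w η : ℕ → EuclideanSpace ℝ (Fin m))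
    (hz : ∀ j, 1 ≤ j → z (j + 1) = proj D (ξ j - α • (mvec P (ξ j) + q + mvec Hᵀ (η j))))
    (hw : ∀ j, 1 ≤ j → w (j + 1) =
      proj (polarCone K) (η j + β • (mvec H ((2 : ℝ) • z (j + 1) - ξ j) - g)))
    (hξ : ∀ j, 1 ≤ j → ξ (j + 1) = (1 - ρ) • ξ j + ρ • z (j + 1))
    (hη : ∀ j, 1 ≤ j → η (j + 1) = (1 - ρ) • η j + ρ • w (j + 1))
    (zbar : EuclideanSpace ℝ (Fin n)) (wbar : EuclideanSpace ℝ (Fin m))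
    (hzbar : Tendsto (fun j : ℕ => z (j + 1) - z j) atTop (𝓝 zbar))
    (hwbar : Tendsto (fun j : ℕ => w (j + 1) - w j) atTop (𝓝 wbar)) :
    0 ≤ supportF D (-(mvec Hᵀ wbar)) +
      ((⟪q, zbar⟫ + ⟪g, wbar⟫ + 1 / (ρ * α) * ‖zbar‖ ^ 2 + 1 / (ρ * β) * ‖wbar‖ ^ 2 : ℝ)
        : EReal) := by
  have hρ0 := hρ.1
  have hr : |1 - ρ| < 1 := abs_lt.2 ⟨by linarith [hρ.2], by linarith⟩
  have hCcl : IsClosed (polarCone K) := by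
    have : polarCone K = ⋂ y ∈ K, {v | ⟪v, y⟫ ≤ 0} := by
      ext v
      simp [polarCone]
    rw [this]
    exact isClosed_biInter fun y _ => isClosed_le (by fun_prop) continuous_const
  have hC0 : (0 : EuclideanSpace ℝ (Fin m)) ∈ polarCone K := fun y _ => by simp
  have hCadd : ∀ u ∈ polarCone K, ∀ v ∈ polarCone K, u + v ∈ polarCone K := by
    intro u hu v hv y hy
    rw [inner_add_left]
    exact add_nonpos (hu y hy) (hv y hy)
  have hCsmul : ∀ u ∈ polarCone K, ∀ c : ℝ, 0 ≤ c → c • u ∈ polarCone K := by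
    intro u hu c hc y hy
    rw [real_inner_smul_left]
    exact mul_nonpos_of_nonneg_of_nonpos hc (hu y hy)
  have hCcv : Convex ℝ (polarCone K) := fun u hu v hv s t hs ht _ =>
    hCadd _ (hCsmul u hu s hs) _ (hCsmul v hv t ht)
  have hadj : ∀ (x : EuclideanSpace ℝ (Fin n)) (y : EuclideanSpace ℝ (Fin m)),
      ⟪mvec Hᵀ y, x⟫ = ⟪y, mvec H x⟫ := by
    intro x y
    unfold mvec
    rw [← Matrix.conjTranspose_eq_transpose_of_trivial,
      Matrix.toEuclideanLin_conjTranspose_eq_adjoint, LinearMap.adjoint_inner_left]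
  have hPker : ∀ x : EuclideanSpace ℝ (Fin n), ⟪mvec P x, x⟫ ≤ 0 → ∀ y, ⟪mvec P y, x⟫ = 0 := by
    intro x hx y
    have hsymm := (Matrix.isPositive_toEuclideanLin_iff.2 hP).isSymmetric
    have h0 : mvec P x = 0 := by
      have h : star (WithLp.ofLp x) ⬝ᵥ (P *ᵥ WithLp.ofLp x) = 0 := by
        refine le_antisymm ?_ (hP.dotProduct_mulVec_nonneg _)
        rw [real_inner_comm, EuclideanSpace.inner_eq_star_dotProduct, dotProduct_comm] at hx
        exact hx
      have h' := (hP.dotProduct_mulVec_zero_iff _).1 h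
      unfold mvec
      rw [Matrix.toLpLin_apply, h']
      rfl
    have h := hsymm y x
    unfold mvec at h0 ⊢
    rw [h, h0, inner_zero_right]
  have hzs (j : ℕ) := hz (j + 1) (by omega) ▸ proj_spec hDne hDcl hDcv _
  have hws (j : ℕ) := hw (j + 1) (by omega) ▸ proj_spec ⟨0, hC0⟩ hCcl hCcv _
  have hzd : Tendsto (fun j => z (j + 2 + 1) - z (j + 2)) atTop (𝓝 zbar) :=
    (tendsto_add_atTop_iff_nat 2).2 hzbar
  have hwd : Tendsto (fun j => w (j + 2 + 1) - w (j + 2)) atTop (𝓝 wbar) :=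
    (tendsto_add_atTop_iff_nat 2).2 hwbar
  have hzx : Tendsto (fun j => z (j + 2) - ξ (j + 1)) atTop (𝓝 (ρ⁻¹ • zbar)) := by
    have h := tendsto_of_affine_recurrence (s := fun j => z (j + 2) - ξ (j + 1)) hr
      (fun j => ?_) hzd
    · simpa using h
    · rw [hξ (j + 1) (by omega)]
      module
  have hwy : Tendsto (fun j => w (j + 2) - η (j + 1)) atTop (𝓝 (ρ⁻¹ • wbar)) := by
    have h := tendsto_of_affine_recurrence (s := fun j => w (j + 2) - η (j + 1)) hr
      (fun j => ?_) hwd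
    · simpa using h
    · rw [hη (j + 1) (by omega)]
      module
  obtain ⟨hq, r, hr, hrz⟩ := asymptotic_primal_dual
    (P := LinearMap.toContinuousLinearMap (Matrix.toEuclideanLin P))
    (H := LinearMap.toContinuousLinearMap (Matrix.toEuclideanLin H))
    (Ht := LinearMap.toContinuousLinearMap (Matrix.toEuclideanLin Hᵀ))
    hadj hPker hDcl hDcv hCcl hC0 hCadd hCsmul hα hβ (fun j => (hzs j).1) (fun j => (hws j).1)
    (fun j => (hzs j).2) (fun j => (hws j).2) hzx hwy
    (tendsto_inv_smul_of_tendsto_sub hzd) (tendsto_inv_smul_of_tendsto_sub hwd)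
  have hS : ((-(⟪g, wbar⟫ + 1 / (ρ * β) * ‖wbar‖ ^ 2) : ℝ) : EReal) ≤
      supportF D (-(mvec Hᵀ wbar)) := by
    refine le_of_tendsto ((continuous_coe_real_ereal.tendsto _).comp hr) (.of_forall fun j => ?_)
    exact (EReal.coe_le_coe_iff.2 (hrz j)).trans
      (le_iSup (fun y : D => ((⟪(y : EuclideanSpace ℝ (Fin n)), -(mvec Hᵀ wbar)⟫ : ℝ) : EReal))
        ⟨z (j + 2), (hzs j).1⟩)
  refine le_trans ?_ (add_le_add_left hS _)
  rw [← EReal.coe_add]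
  exact EReal.coe_nonneg.2 (by linarith)
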